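/- arXiv:1401.6869 — 2 statements merged into one kernel-verified Lean document; each statement's English description precedes it below -/
import Mathlib

section
/- For a multivalued mapping T : X ⇉ Y, the following assertions are equivalent: (1) T is c-monotone; (2) Δ_T is C-monotone; (3) Δ_T is C-cyclically monotone; (4) G(Δ_T) ⊆ G(∂_C (c + ι_{G(T)})), i.e. c + ι_{G(T)} is a C-antiderivative of Δ_T. -/
/-- A function into `(-∞,+∞]` (modeled as `EReal` never taking `⊥`) is proper if it is
finite somewhere. -/
def EProper {A : Type*} (f : A → EReal) : Prop :=
  (∀ a, f a ≠ ⊥) ∧ ∃ a, f a ≠ ⊤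

/-- The `c`-transform `f^c(b) = sup_a (c(a,b) - f(a))`. -/
noncomputable def cTransform {A B : Type*} (k : A → B → ℝ) (f : A → EReal) : B → EReal :=
  fun b => ⨆ a, (k a b : EReal) - f a

/-- The `c`-subdifferential `∂_c f(a) = {b | ∀ a', f(a) + c(a',b) ≤ f(a') + c(a,b)}`. -/
def cSubdiff {A B : Type*} (k : A → B → ℝ) (f : A → EReal) (a : A) : Set B :=
  {b | ∀ a', f a + (k a' b : EReal) ≤ f a' + (k a b : EReal)}

/-- A proper function `f` is `c`-convex if it is the `c`-transform of some
`(-∞,+∞]`-valued function on the other set. -/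
def CConvexWith {A B : Type*} (k : A → B → ℝ) (f : A → EReal) : Prop :=
  EProper f ∧ ∃ g : B → EReal, (∀ b, g b ≠ ⊥) ∧ f = cTransform (fun b a => k a b) g

/-- `f` is a `c`-antiderivative of `M` if `G(M) ⊆ G(∂_c f)`. -/
def IsCAntideriv {A B : Type*} (k : A → B → ℝ) (f : A → EReal) (M : A → Set B) : Prop :=
  ∀ a b, b ∈ M a → b ∈ cSubdiff k f a

/-- `c`-monotonicity (2-monotonicity) of a multivalued mapping with respect to a coupling. -/
def CMonotone {A B : Type*} (k : A → B → ℝ) (N : A → Set B) : Prop :=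
  ∀ a₁ b₁ a₂ b₂, b₁ ∈ N a₁ → b₂ ∈ N a₂ →
    0 ≤ k a₁ b₁ - k a₁ b₂ - k a₂ b₁ + k a₂ b₂

/-- `c`-cyclic monotonicity of a multivalued mapping with respect to a coupling. -/
def CCyclicMonotone {A B : Type*} (k : A → B → ℝ) (N : A → Set B) : Prop :=
  ∀ (n : ℕ) (a : Fin (n + 1) → A) (b : Fin (n + 1) → B),
    (∀ i, b i ∈ N (a i)) →
    0 ≤ ∑ i : Fin (n + 1), (k (a i) (b i) - k (a (i + 1)) (b i))

/-- The coupling `C((x,y),(t,s)) = c(x,t) + c(s,y)` on `(X × Y) × (Y × X)`. -/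
def couplingC {X Y : Type*} (c : X → Y → ℝ) : X × Y → Y × X → ℝ :=
  fun p q => c p.1 q.1 + c q.2 p.2

/-- The mapping `Δ_T : X × Y ⇉ Y × X` with graph `{((x,y),(y,x)) | (x,y) ∈ G(T)}`. -/
def DeltaT {X Y : Type*} (T : X → Set Y) : X × Y → Set (Y × X) :=
  fun p => {q | q = (p.2, p.1) ∧ p.2 ∈ T p.1}

theorem cMonotone_couplingC_iff {X Y : Type*} (c : X → Y → ℝ) (T : X → Set Y) :
    CMonotone (couplingC c) (DeltaT T) ↔ CMonotone c T := by
  constructor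
  · intro h x₁ y₁ x₂ y₂ h₁ h₂
    have := h (x₁, y₁) (y₁, x₁) (x₂, y₂) (y₂, x₂) ⟨rfl, h₁⟩ ⟨rfl, h₂⟩
    simp only [couplingC] at this
    linarith
  · rintro h ⟨x₁, y₁⟩ _ ⟨x₂, y₂⟩ _ ⟨rfl, h₁⟩ ⟨rfl, h₂⟩
    have := h x₁ y₁ x₂ y₂ h₁ h₂
    simp only [couplingC]
    linarith

theorem CCyclicMonotone.cMonotone {A B : Type*} {k : A → B → ℝ} {N : A → Set B}
    (h : CCyclicMonotone k N) : CMonotone k N := by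
  intro a₁ b₁ a₂ b₂ h₁ h₂
  have := h 1 ![a₁, a₂] ![b₁, b₂] (by simp [Fin.forall_fin_two, h₁, h₂])
  simp [Fin.sum_univ_two] at this
  linarith

theorem CMonotone.cCyclicMonotone_deltaT {X Y : Type*} {c : X → Y → ℝ} {T : X → Set Y}
    (h : CMonotone c T) : CCyclicMonotone (couplingC c) (DeltaT T) := by
  intro n a b hab
  have shift : ∑ i, c (a (i + 1)).1 (a (i + 1)).2 = ∑ i, c (a i).1 (a i).2 :=
    Equiv.sum_comp (Equiv.addRight (1 : Fin (n + 1))) fun i => c (a i).1 (a i).2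
  have key : ∑ i, (couplingC c (a i) (b i) - couplingC c (a (i + 1)) (b i)) =
      ∑ i, (c (a i).1 (a i).2 - c (a i).1 (a (i + 1)).2 - c (a (i + 1)).1 (a i).2
        + c (a (i + 1)).1 (a (i + 1)).2) := by
    simp only [couplingC, (hab _).1, Finset.sum_add_distrib, Finset.sum_sub_distrib, shift]
    ring
  rw [key]
  exact Finset.sum_nonneg fun i _ => h _ _ _ _ (hab i).2 (hab (i + 1)).2

open Classical in
theorem isCAntideriv_deltaT_iff {X Y : Type*} (c : X → Y → ℝ) (T : X → Set Y) :
    IsCAntideriv (couplingC c)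
      (fun p : X × Y => if p.2 ∈ T p.1 then (c p.1 p.2 : EReal) else ⊤) (DeltaT T) ↔
      CMonotone c T := by
  constructor
  · intro h x₁ y₁ x₂ y₂ h₁ h₂
    have := h (x₁, y₁) (y₁, x₁) ⟨rfl, h₁⟩ (x₂, y₂)
    simp only [couplingC, if_pos h₁, if_pos h₂] at this
    norm_cast at this
    linarith
  · rintro h ⟨x₁, y₁⟩ _ ⟨rfl, h₁⟩ ⟨x₂, y₂⟩
    by_cases h₂ : y₂ ∈ T x₂
    · have := h x₁ y₁ x₂ y₂ h₁ h₂
      simp only [couplingC, if_pos h₁, if_pos h₂]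
      norm_cast
      linarith
    · simp only [if_neg h₂, EReal.top_add_coe, le_top]

open Classical in
/-- `T` is `c`-monotone iff `Δ_T` is `C`-monotone iff `Δ_T` is `C`-cyclically
monotone iff `c + ι_{G(T)}` is a `C`-antiderivative of `Δ_T`. -/
theorem cMonotone_iff_deltaT {X Y : Type*} [Nonempty X] [Nonempty Y]
    (c : X → Y → ℝ) (T : X → Set Y) :
    (CMonotone c T ↔ CMonotone (couplingC c) (DeltaT T)) ∧
    (CMonotone (couplingC c) (DeltaT T) ↔ CCyclicMonotone (couplingC c) (DeltaT T)) ∧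
    (CCyclicMonotone (couplingC c) (DeltaT T) ↔
      IsCAntideriv (couplingC c)
        (fun p : X × Y => if p.2 ∈ T p.1 then (c p.1 p.2 : EReal) else ⊤) (DeltaT T)) := by
  have cyclic_iff : CCyclicMonotone (couplingC c) (DeltaT T) ↔ CMonotone c T :=
    ⟨fun h => (cMonotone_couplingC_iff c T).1 h.cMonotone, fun h => h.cCyclicMonotone_deltaT⟩
  exact ⟨(cMonotone_couplingC_iff c T).symm,
    (cMonotone_couplingC_iff c T).trans cyclic_iff.symm,
    cyclic_iff.trans (isCAntideriv_deltaT_iff c T).symm⟩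
end

section
/- Let T : X ⇉ Y be a proper c-monotone mapping. Then the Fitzpatrick function F_{[c,T]} equals the lower envelope α_{[C,c|_{G(T)},Δ_T]} of the family 𝒜_{[C,c|_{G(T)},Δ_T]}; in particular, F_{[c,T]} is the minimal C-convex C-antiderivative of Δ_T that agrees with c on G(T). If, in addition, T is maximal c-monotone, then c ≤ F_{[c,T]} pointwise and 𝒜_{[C,c|_{G(T)},Δ_T]} ⊆ ℱ_{[c,T]}, where ℱ_{[c,T]} := {h : X×Y → (−∞,+∞] | h is C-convex, c ≤ h pointwise, and h = c on G(T)} is the Fitzpatrick family of T. -/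
/-- The family `𝒜_{[c,f|_S,M]}` of all `c`-convex `c`-antiderivatives of `M`
agreeing with `f` on `S`. -/
def AFam {A B : Type*} (k : A → B → ℝ) (f : A → EReal) (S : Set A) (M : A → Set B) :
    Set (A → EReal) :=
  {h | CConvexWith k h ∧ IsCAntideriv k h M ∧ ∀ s ∈ S, h s = f s}

/-- The Fitzpatrick function `F_{[c,T]}(x,y) = sup_{(s,t)∈G(T)} [c(x,t) + c(s,y) − c(s,t)]`. -/
noncomputable def FitzpatrickFn {X Y : Type*} (c : X → Y → ℝ) (T : X → Set Y) :
    X × Y → EReal :=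
  fun p => ⨆ s, ⨆ t ∈ T s, ((c p.1 t + c s p.2 - c s t : ℝ) : EReal)

/-- The Fitzpatrick family `ℱ_{[c,T]}`. -/
def FitzpatrickFamily {X Y : Type*} (c : X → Y → ℝ) (T : X → Set Y) :
    Set (X × Y → EReal) :=
  {h | CConvexWith (couplingC c) h ∧ (∀ p : X × Y, ((c p.1 p.2 : ℝ) : EReal) ≤ h p) ∧
    ∀ p : X × Y, p.2 ∈ T p.1 → h p = ((c p.1 p.2 : ℝ) : EReal)}

/-- The affine terms of the Fitzpatrick function lie below it. -/
theorem le_fitzpatrickFn {X Y : Type*} (c : X → Y → ℝ) {T : X → Set Y} {s : X} {t : Y}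
    (hst : t ∈ T s) (p : X × Y) :
    ((c p.1 t + c s p.2 - c s t : ℝ) : EReal) ≤ FitzpatrickFn c T p :=
  le_iSup_of_le s (le_iSup₂_of_le t hst le_rfl)

/-- The Fitzpatrick function of a `c`-monotone mapping agrees with `c` on the graph. -/
theorem fitzpatrickFn_eq_of_mem {X Y : Type*} {c : X → Y → ℝ} {T : X → Set Y}
    (hmono : CMonotone c T) {p : X × Y} (hp : p.2 ∈ T p.1) :
    FitzpatrickFn c T p = ((c p.1 p.2 : ℝ) : EReal) := by
  refine le_antisymm (iSup_le fun s => iSup₂_le fun t hst => ?_) ?_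
  · have := hmono _ _ _ _ hp hst
    exact EReal.coe_le_coe_iff.2 (by linarith)
  · simpa using le_fitzpatrickFn c hp p

/-- For a function equal to `c` at a point, `C`-subgradient inequalities on the diagonal amount
to the affine lower bounds that define the Fitzpatrick function. -/
theorem mem_cSubdiff_couplingC_iff {X Y : Type*} {c : X → Y → ℝ} {h : X × Y → EReal}
    {s : X} {t : Y} (hst : h (s, t) = ((c s t : ℝ) : EReal)) :
    (t, s) ∈ cSubdiff (couplingC c) h (s, t) ↔
      ∀ p : X × Y, ((c p.1 t + c s p.2 - c s t : ℝ) : EReal) ≤ h p := by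
  refine forall_congr' fun p => ?_
  rw [hst]
  simp only [couplingC]
  induction h p with
  | bot =>
    rw [EReal.bot_add, le_bot_iff, le_bot_iff, ← EReal.coe_add]
    exact iff_of_false (EReal.coe_ne_bot _) (EReal.coe_ne_bot _)
  | coe r =>
    rw [← EReal.coe_add, ← EReal.coe_add, EReal.coe_le_coe_iff, EReal.coe_le_coe_iff]
    constructor <;> intro _ <;> linarith
  | top => rw [EReal.top_add_coe]; exact iff_of_true le_top le_top

/-- The Fitzpatrick function of a proper `c`-monotone mapping is `C`-convex. -/
theorem cConvexWith_fitzpatrickFn {X Y : Type*} {c : X → Y → ℝ} {T : X → Set Y}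
    (hT : ∃ x, (T x).Nonempty) (hmono : CMonotone c T) :
    CConvexWith (couplingC c) (FitzpatrickFn c T) := by
  classical
  obtain ⟨x, y, hxy⟩ := hT
  refine ⟨⟨fun p => ?_, (x, y), ?_⟩,
    fun q => if q.1 ∈ T q.2 then ((c q.2 q.1 : ℝ) : EReal) else ⊤, fun q => ?_, ?_⟩
  · exact ne_bot_of_le_ne_bot (EReal.coe_ne_bot _) (le_fitzpatrickFn c hxy p)
  · rw [fitzpatrickFn_eq_of_mem hmono (p := (x, y)) hxy]
    exact EReal.coe_ne_top _
  · dsimp only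
    split_ifs
    · exact EReal.coe_ne_bot _
    · exact top_ne_bot
  · funext p
    refine le_antisymm (iSup_le fun s => iSup₂_le fun t hst => ?_) (iSup_le fun q => ?_)
    · refine le_iSup_of_le (t, s) ?_
      simp only [couplingC, if_pos hst, ← EReal.coe_sub, le_refl]
    · by_cases hq : q.1 ∈ T q.2
      · simpa only [couplingC, if_pos hq, ← EReal.coe_sub] using le_fitzpatrickFn c hq p
      · simp only [if_neg hq, EReal.sub_top, bot_le]

/-- For a maximal `c`-monotone mapping, the Fitzpatrick function majorizes `c`. -/
theorem le_fitzpatrickFn_of_maximal {X Y : Type*} {c : X → Y → ℝ} {T : X → Set Y}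
    (hmono : CMonotone c T)
    (hmax : ∀ T' : X → Set Y, CMonotone c T' →
      (∀ x y, y ∈ T x → y ∈ T' x) → ∀ x y, y ∈ T' x → y ∈ T x) (p : X × Y) :
    ((c p.1 p.2 : ℝ) : EReal) ≤ FitzpatrickFn c T p := by
  by_contra! hlt
  have key : ∀ s t, t ∈ T s → c p.1 t + c s p.2 - c s t < c p.1 p.2 := fun s t hst =>
    EReal.coe_lt_coe_iff.1 ((le_fitzpatrickFn c hst p).trans_lt hlt)
  have hp : p.2 ∈ T p.1 := by
    refine hmax (fun x => {y | y ∈ T x ∨ (x = p.1 ∧ y = p.2)}) ?_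
      (fun _ _ => Or.inl) _ _ (Or.inr ⟨rfl, rfl⟩)
    rintro a₁ b₁ a₂ b₂ (h₁ | ⟨rfl, rfl⟩) (h₂ | ⟨rfl, rfl⟩)
    · exact hmono _ _ _ _ h₁ h₂
    · linarith [key _ _ h₁]
    · linarith [key _ _ h₂]
    · linarith
  exact hlt.ne (fitzpatrickFn_eq_of_mem hmono hp)

/-- for a proper `c`-monotone `T`, the Fitzpatrick function is the lower
envelope of `𝒜_{[C,c|_{G(T)},Δ_T]}` and its minimal member; if `T` is maximal `c`-monotone,
then `c ≤ F_{[c,T]}` and `𝒜_{[C,c|_{G(T)},Δ_T]} ⊆ ℱ_{[c,T]}`. -/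
theorem fitzpatrick_minimal_antiderivative {X Y : Type*} [Nonempty X] [Nonempty Y]
    (c : X → Y → ℝ) (T : X → Set Y) (hT : ∃ x, (T x).Nonempty)
    (hmono : CMonotone c T) :
    (∀ p : X × Y,
      FitzpatrickFn c T p =
        ⨅ h ∈ AFam (couplingC c) (fun p : X × Y => ((c p.1 p.2 : ℝ) : EReal))
          {p : X × Y | p.2 ∈ T p.1} (DeltaT T), h p) ∧
    FitzpatrickFn c T ∈
      AFam (couplingC c) (fun p : X × Y => ((c p.1 p.2 : ℝ) : EReal))
        {p : X × Y | p.2 ∈ T p.1} (DeltaT T) ∧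
    (∀ h ∈ AFam (couplingC c) (fun p : X × Y => ((c p.1 p.2 : ℝ) : EReal))
        {p : X × Y | p.2 ∈ T p.1} (DeltaT T),
      ∀ p, FitzpatrickFn c T p ≤ h p) ∧
    ((CMonotone c T ∧ ∀ T' : X → Set Y, CMonotone c T' →
        (∀ x y, y ∈ T x → y ∈ T' x) → ∀ x y, y ∈ T' x → y ∈ T x) →
      (∀ p : X × Y, ((c p.1 p.2 : ℝ) : EReal) ≤ FitzpatrickFn c T p) ∧
      AFam (couplingC c) (fun p : X × Y => ((c p.1 p.2 : ℝ) : EReal))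
          {p : X × Y | p.2 ∈ T p.1} (DeltaT T) ⊆ FitzpatrickFamily c T) := by
  have hmem : FitzpatrickFn c T ∈
      AFam (couplingC c) (fun p : X × Y => ((c p.1 p.2 : ℝ) : EReal))
        {p : X × Y | p.2 ∈ T p.1} (DeltaT T) := by
    refine ⟨cConvexWith_fitzpatrickFn hT hmono, ?_, fun p hp => fitzpatrickFn_eq_of_mem hmono hp⟩
    rintro ⟨s, t⟩ _ ⟨rfl, hst⟩
    exact (mem_cSubdiff_couplingC_iff (fitzpatrickFn_eq_of_mem hmono hst)).2
      (le_fitzpatrickFn c hst)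
  have hmin : ∀ h ∈ AFam (couplingC c) (fun p : X × Y => ((c p.1 p.2 : ℝ) : EReal))
        {p : X × Y | p.2 ∈ T p.1} (DeltaT T),
      ∀ p, FitzpatrickFn c T p ≤ h p := by
    rintro h ⟨-, hanti, heq⟩ p
    exact iSup_le fun s => iSup₂_le fun t hst =>
      (mem_cSubdiff_couplingC_iff (heq (s, t) hst)).1 (hanti (s, t) (t, s) ⟨rfl, hst⟩) p
  refine ⟨fun p => le_antisymm (le_iInf₂ fun h hh => hmin h hh p) (iInf₂_le _ hmem),
    hmem, hmin, fun hmax => ?_⟩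
  have hle := le_fitzpatrickFn_of_maximal hmono hmax.2
  exact ⟨hle, fun h hh => ⟨hh.1, fun p => (hle p).trans (hmin h hh p), hh.2.2⟩⟩
end
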